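/- Let α > 0, let r satisfy 0 < r ≤ α, and let ρ satisfy 0 < ρ ≤ r/2. Set h₁ = ρ(2α−ρ)/(2(α+r−ρ)) and 𝒞(h₁) = {x ∈ ℝ² : −h₁ ≤ ⟨x,e₂⟩ ≤ 0} ∩ B(−r e₂, r). Then 𝒞(h₁) ⊆ B((α−ρ)e₂, α). -/

import Mathlib

open MeasureTheory Metric Set
open scoped RealInnerProductSpace ENNReal

noncomputable section

/-- The Euclidean plane. -/
abbrev E2 := EuclideanSpace ℝ (Fin 2)

/-- The point `(a, b)` of the Euclidean plane. -/
def pt (a b : ℝ) : E2 := (WithLp.equiv 2 (Fin 2 → ℝ)).symm ![a, b]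

/-- The unit vector `e₂ = (0, 1)`. -/
def e₂ : E2 := pt 0 1

/-- `𝒞(h) = {x : −h ≤ ⟪x, e₂⟫ ≤ 0} ∩ B(−r e₂, r)`. -/
def Cset (h r : ℝ) : Set E2 :=
  {x : E2 | -h ≤ ⟪x, e₂⟫ ∧ ⟪x, e₂⟫ ≤ 0} ∩ closedBall (-(r • e₂)) r

theorem statement14
    (α r ρ : ℝ) (hα : 0 < α) (hr : 0 < r) (hrα : r ≤ α) (hρ : 0 < ρ) (hρr : ρ ≤ r / 2)
    (h₁ : ℝ) (hh₁ : h₁ = ρ * (2 * α - ρ) / (2 * (α + r - ρ))) :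
    Cset h₁ r ⊆ closedBall ((α - ρ) • e₂) α := by
  rintro x ⟨⟨hx1, -⟩, hx3⟩
  have he : ‖e₂‖ ^ 2 = 1 := by
    rw [EuclideanSpace.norm_sq_eq]
    simp [e₂, pt]
  rw [mem_closedBall, dist_eq_norm] at hx3 ⊢
  have h1 : ‖x - -(r • e₂)‖ ^ 2 ≤ r ^ 2 := by gcongr
  rw [sub_neg_eq_add, norm_add_sq_real, inner_smul_right, norm_smul, mul_pow, he,
    Real.norm_eq_abs, sq_abs] at h1
  have hpos : 0 < α + r - ρ := by linarith
  have h2 : h₁ * (2 * (α + r - ρ)) = ρ * (2 * α - ρ) := by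
    rw [hh₁]
    field_simp
  refine (pow_le_pow_iff_left₀ (norm_nonneg _) hα.le two_ne_zero).1 ?_
  rw [norm_sub_sq_real, inner_smul_right, norm_smul, mul_pow, he,
    Real.norm_eq_abs, sq_abs]
  nlinarith [mul_le_mul_of_nonneg_right hx1 hpos.le]
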